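/- arXiv:2005.09611 — 3 statements merged into one kernel-verified Lean document; each statement's English description precedes it below -/
import Mathlib

section
/- Let T1 ⊆ T2 be quadtrees and suppose T1 admits at least one abstract path. Then T2 admits an abstract path, and the minimum of Ĵ over abstract paths in T2 is at most the minimum of Ĵ over abstract paths in T1. -/
open Finset Filter

/-- The penalty constant `M = 2^{dℓ}(λ₁ + ε λ₂) + γ`. -/
noncomputable def Mval (d ℓ : ℕ) (ε lam1 lam2 γ : ℝ) : ℝ :=
  2 ^ (d * ℓ) * (lam1 + ε * lam2) + γ

/-- The cost `c` on leaves. -/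
noncomputable def cst (d ℓ : ℕ) (p : List (Fin (2 ^ d)) → ℝ) (ε lam1 lam2 γ : ℝ)
    (x : List (Fin (2 ^ d))) : ℝ :=
  if p x ≤ ε then lam1 + lam2 * p x else Mval d ℓ ε lam1 lam2 γ

/-- Auxiliary recursion for `V`, with fuel equal to `ℓ - length`. -/
noncomputable def Vaux (d : ℕ) (c : List (Fin (2 ^ d)) → ℝ) : ℕ → List (Fin (2 ^ d)) → ℝ
  | 0, n => c n
  | k + 1, n => ((2 : ℝ) ^ d)⁻¹ * ∑ i : Fin (2 ^ d), Vaux d c k (n ++ [i])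

/-- The function `V`: `V(n) = c(n)` on leaves (length `ℓ`), and
`V(n) = 2^{-d} ∑_{n' child of n} V(n')` on interior nodes. -/
noncomputable def Vnode (d ℓ : ℕ) (c : List (Fin (2 ^ d)) → ℝ) (n : List (Fin (2 ^ d))) : ℝ :=
  Vaux d c (ℓ - n.length) n

/-- A quadtree: a set of nodes (lists of length ≤ ℓ) containing the root, closed under
parents, and sibling-complete. -/
def IsQuadtree (d ℓ : ℕ) (T : Set (List (Fin (2 ^ d)))) : Prop :=
  [] ∈ T ∧ (∀ n ∈ T, n.length ≤ ℓ) ∧ (∀ n ∈ T, n ≠ [] → n.dropLast ∈ T) ∧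
    ∀ (n : List (Fin (2 ^ d))) (i j : Fin (2 ^ d)), n ++ [i] ∈ T → n ++ [j] ∈ T

/-- A leaf of a quadtree `T`: an element of `T` none of whose children lies in `T`. -/
def IsLeafOf (d : ℕ) (T : Set (List (Fin (2 ^ d)))) (n : List (Fin (2 ^ d))) : Prop :=
  n ∈ T ∧ ∀ i : Fin (2 ^ d), n ++ [i] ∉ T

/-- The `i`-th coordinate of the center of the hypercube represented by node `n`. -/
noncomputable def center (d ℓ : ℕ) (n : List (Fin (2 ^ d))) (i : Fin d) : ℝ :=
  (∑ j : Fin n.length,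
      ((((n.get j).val / 2 ^ (i : ℕ)) % 2 : ℕ) : ℝ) * (2 : ℝ) ^ ((ℓ : ℤ) - (j : ℕ) - 1)) +
    (2 : ℝ) ^ ((ℓ : ℤ) - (n.length : ℕ) - 1)

/-- Nodal neighbors: the sup-distance of the centers equals `2^{r(n)-1} + 2^{r(m)-1}`
and exactly one coordinate realizes this value. -/
def NodalNeighbors (d ℓ : ℕ) (n m : List (Fin (2 ^ d))) : Prop :=
  (∀ i : Fin d, |center d ℓ n i - center d ℓ m i| ≤
      (2 : ℝ) ^ ((ℓ : ℤ) - (n.length : ℕ) - 1) + (2 : ℝ) ^ ((ℓ : ℤ) - (m.length : ℕ) - 1)) ∧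
    ∃! i : Fin d, |center d ℓ n i - center d ℓ m i| =
      (2 : ℝ) ^ ((ℓ : ℤ) - (n.length : ℕ) - 1) + (2 : ℝ) ^ ((ℓ : ℤ) - (m.length : ℕ) - 1)

/-- An abstract path in the quadtree `T` from start leaf `s0` to goal leaf `sg`. -/
structure AbstractPath (d ℓ : ℕ) (T : Set (List (Fin (2 ^ d)))) (s0 sg : List (Fin (2 ^ d))) where
  R : ℕ
  z : Fin (R + 1) → List (Fin (2 ^ d))
  inj : Function.Injective z
  leaf : ∀ i, IsLeafOf d T (z i)
  start : z 0 <+: s0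
  goal : z (Fin.last R) <+: sg
  neigh : ∀ i : Fin R, NodalNeighbors d ℓ (z i.castSucc) (z i.succ)

/-- The cost `Ĵ` of an abstract path. -/
noncomputable def pathCost (d ℓ : ℕ) (c : List (Fin (2 ^ d)) → ℝ) {T : Set (List (Fin (2 ^ d)))}
    {s0 sg : List (Fin (2 ^ d))} (pth : AbstractPath d ℓ T s0 sg) : ℝ :=
  ∑ i, (2 : ℝ) ^ (d * (ℓ - (pth.z i).length)) * Vnode d ℓ c (pth.z i)

/-- An abstract path is ε-feasible if every leaf descendant of every node of the path
has occupancy probability at most ε. -/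
def EpsFeasible (d ℓ : ℕ) (p : List (Fin (2 ^ d)) → ℝ) (ε : ℝ) {T : Set (List (Fin (2 ^ d)))}
    {s0 sg : List (Fin (2 ^ d))} (pth : AbstractPath d ℓ T s0 sg) : Prop :=
  ∀ i, ∀ x : List (Fin (2 ^ d)), pth.z i <+: x → x.length = ℓ → p x ≤ ε

/-- The `i`-th coordinate of the lower corner of the cube of a node, in units of finest cells. -/
def corner (d : ℕ) : ℕ → List (Fin (2 ^ d)) → Fin d → ℕ
  | _, [], _ => 0
  | 0, _ :: _, _ => 0
  | k + 1, a :: n, i => (a.val / 2 ^ (i : ℕ) % 2) * 2 ^ k + corner d k n i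

/-- The finest cell with integer coordinates `q` lies in the cube of the node `n`. -/
def Covers (d ℓ : ℕ) (n : List (Fin (2 ^ d))) (q : Fin d → ℕ) : Prop :=
  ∀ i, corner d ℓ n i ≤ q i ∧ q i < corner d ℓ n i + 2 ^ (ℓ - n.length)

theorem two_zpow_half {ℓ k : ℕ} (h : k ≤ ℓ) :
    (2 : ℝ) ^ ((ℓ : ℤ) - (k : ℕ) - 1) = ((2 ^ (ℓ - k) : ℕ) : ℝ) / 2 := by
  rw [zpow_sub_one₀ two_ne_zero, ← Nat.cast_sub h, zpow_natCast]
  push_cast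
  ring

theorem center_eq_corner {d ℓ : ℕ} {n : List (Fin (2 ^ d))} (h : n.length ≤ ℓ) (i : Fin d) :
    center d ℓ n i = corner d ℓ n i + ((2 ^ (ℓ - n.length) : ℕ) : ℝ) / 2 := by
  unfold center
  rw [two_zpow_half h]
  congr 1
  induction n generalizing ℓ with
  | nil => cases ℓ <;> simp [corner]
  | cons a n ih =>
    obtain ⟨k, rfl⟩ : ∃ k, ℓ = k + 1 := ⟨ℓ - 1, by simp at h; omega⟩
    have h' : n.length ≤ k := by simpa using h
    simp only [corner, List.length_cons]
    rw [Fin.sum_univ_succ]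
    push_cast
    rw [← ih h']
    congr 1
    · simp
    · refine Finset.sum_congr rfl fun j _ => ?_
      simp only [List.get_eq_getElem, Fin.val_succ, List.getElem_cons_succ]
      push_cast
      congr 2
      ring

theorem nodalNeighbors_iff {d ℓ : ℕ} {n m : List (Fin (2 ^ d))}
    (hn : n.length ≤ ℓ) (hm : m.length ≤ ℓ) :
    NodalNeighbors d ℓ n m ↔
      (∀ i, corner d ℓ n i ≤ corner d ℓ m i + 2 ^ (ℓ - m.length) ∧
        corner d ℓ m i ≤ corner d ℓ n i + 2 ^ (ℓ - n.length)) ∧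
      ∃! i, corner d ℓ n i = corner d ℓ m i + 2 ^ (ℓ - m.length) ∨
        corner d ℓ m i = corner d ℓ n i + 2 ^ (ℓ - n.length) := by
  have key : ∀ x y A B : ℕ,
      (|((x : ℝ) + (A : ℝ) / 2) - ((y : ℝ) + (B : ℝ) / 2)| ≤ (A : ℝ) / 2 + (B : ℝ) / 2 ↔
        x ≤ y + B ∧ y ≤ x + A) ∧
      (|((x : ℝ) + (A : ℝ) / 2) - ((y : ℝ) + (B : ℝ) / 2)| = (A : ℝ) / 2 + (B : ℝ) / 2 ↔
        x = y + B ∨ y = x + A) := by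
    intro x y A B
    constructor
    · rw [abs_le, ← Nat.cast_le (α := ℝ), ← Nat.cast_le (α := ℝ)]
      push_cast
      constructor <;> rintro ⟨h1, h2⟩ <;> constructor <;> linarith
    · rw [abs_eq (by positivity), ← Nat.cast_inj (R := ℝ), ← Nat.cast_inj (R := ℝ)]
      push_cast
      constructor <;> rintro (h | h)
      · left; linarith
      · right; linarith
      · left; linarith
      · right; linarith
  unfold NodalNeighbors
  simp only [center_eq_corner hn, center_eq_corner hm, two_zpow_half hn, two_zpow_half hm, key]

theorem NodalNeighbors.symm {d ℓ : ℕ} {n m : List (Fin (2 ^ d))}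
    (h : NodalNeighbors d ℓ n m) : NodalNeighbors d ℓ m n := by
  unfold NodalNeighbors at *
  simpa only [abs_sub_comm, add_comm] using h

theorem not_nodalNeighbors_self {d ℓ : ℕ} (n : List (Fin (2 ^ d))) :
    ¬ NodalNeighbors d ℓ n n := by
  rintro ⟨-, i, hi, -⟩
  simp only [sub_self, abs_zero] at hi
  have : (0 : ℝ) < (2 : ℝ) ^ ((ℓ : ℤ) - (n.length : ℕ) - 1) := by positivity
  linarith

theorem corner_add_le {d ℓ : ℕ} {n : List (Fin (2 ^ d))} (h : n.length ≤ ℓ) (i : Fin d) :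
    corner d ℓ n i + 2 ^ (ℓ - n.length) ≤ 2 ^ ℓ := by
  induction n generalizing ℓ with
  | nil => cases ℓ <;> simp [corner]
  | cons a n ih =>
    obtain ⟨k, rfl⟩ : ∃ k, ℓ = k + 1 := ⟨ℓ - 1, by simp at h; omega⟩
    have := ih (ℓ := k) (by simpa using h)
    simp only [corner, List.length_cons, Nat.add_sub_add_right, pow_succ]
    have hb : a.val / 2 ^ (i : ℕ) % 2 ≤ 1 := by omega
    have := Nat.mul_le_mul_right (2 ^ k) hb
    omega

theorem corner_append {d ℓ : ℕ} {n : List (Fin (2 ^ d))} (t : List (Fin (2 ^ d)))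
    (h : n.length ≤ ℓ) (i : Fin d) :
    corner d ℓ (n ++ t) i = corner d ℓ n i + corner d (ℓ - n.length) t i := by
  induction n generalizing ℓ with
  | nil => cases ℓ <;> simp [corner]
  | cons a n ih =>
    obtain ⟨k, rfl⟩ : ∃ k, ℓ = k + 1 := ⟨ℓ - 1, by simp at h; omega⟩
    simp only [List.cons_append, corner, ih (ℓ := k) (by simpa using h), List.length_cons,
      Nat.add_sub_add_right, add_assoc]

theorem covers_corner {d ℓ : ℕ} (n : List (Fin (2 ^ d))) : Covers d ℓ n (corner d ℓ n) :=
  fun _ => ⟨le_rfl, Nat.lt_add_of_pos_right (by positivity)⟩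

theorem Covers.of_prefix {d ℓ : ℕ} {n m : List (Fin (2 ^ d))} {q : Fin d → ℕ}
    (h : Covers d ℓ m q) (hm : m.length ≤ ℓ) (hnm : n <+: m) : Covers d ℓ n q := by
  obtain ⟨t, rfl⟩ := hnm
  rw [List.length_append] at hm
  intro i
  have h1 := h i
  rw [corner_append t (by omega) i, List.length_append] at h1
  have h2 := corner_add_le (n := t) (ℓ := ℓ - n.length) (by omega) i
  rw [← Nat.sub_sub] at h1
  omega

theorem bits_injective (d : ℕ) :
    Function.Injective (fun (a : Fin (2 ^ d)) (i : Fin d) => a.val.testBit i) := by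
  intro a b h
  apply Fin.ext
  apply Nat.eq_of_testBit_eq
  intro i
  by_cases hi : i < d
  · exact congrFun h ⟨i, hi⟩
  · have hle : 2 ^ d ≤ 2 ^ i := Nat.pow_le_pow_right two_pos (by omega)
    rw [Nat.testBit_lt_two_pow (a.isLt.trans_le hle), Nat.testBit_lt_two_pow (b.isLt.trans_le hle)]

theorem bits_surjective (d : ℕ) :
    Function.Surjective (fun (a : Fin (2 ^ d)) (i : Fin d) => a.val.testBit i) :=
  ((Fintype.bijective_iff_injective_and_card _).2 ⟨bits_injective d, by simp⟩).2

theorem eq_of_bits_eq {d : ℕ} {a b : Fin (2 ^ d)}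
    (h : ∀ i : Fin d, a.val / 2 ^ (i : ℕ) % 2 = b.val / 2 ^ (i : ℕ) % 2) : a = b := by
  apply bits_injective d
  funext i
  simp only [Nat.testBit_eq_decide_div_mod_eq, h i]

theorem exists_bits {d : ℕ} (f : Fin d → ℕ) (hf : ∀ i, f i < 2) :
    ∃ a : Fin (2 ^ d), ∀ i : Fin d, a.val / 2 ^ (i : ℕ) % 2 = f i := by
  obtain ⟨a, ha⟩ := bits_surjective d (fun i => decide (f i = 1))
  refine ⟨a, fun i => ?_⟩
  have h1 := congrFun ha i
  simp only [Nat.testBit_eq_decide_div_mod_eq, decide_eq_decide] at h1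
  have := hf i
  omega

theorem exists_corner_eq {d : ℕ} (ℓ : ℕ) (q : Fin d → ℕ) (hq : ∀ i, q i < 2 ^ ℓ) :
    ∃ x : List (Fin (2 ^ d)), x.length = ℓ ∧ corner d ℓ x = q := by
  induction ℓ generalizing q with
  | zero =>
    refine ⟨[], rfl, funext fun i => ?_⟩
    have := hq i
    simp [corner] at *
    omega
  | succ k ih =>
    obtain ⟨a, ha⟩ := exists_bits (fun i => q i / 2 ^ k)
      (fun i => Nat.div_lt_of_lt_mul (by simpa [pow_succ] using hq i))
    obtain ⟨x, hx, hxq⟩ := ih (fun i => q i % 2 ^ k) (fun i => Nat.mod_lt _ (by positivity))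
    refine ⟨a :: x, by simp [hx], funext fun i => ?_⟩
    simp only [corner, ha, hxq]
    rw [mul_comm]
    exact Nat.div_add_mod _ _

theorem prefix_of_covers {d ℓ : ℕ} {n m : List (Fin (2 ^ d))} {q : Fin d → ℕ}
    (hn : Covers d ℓ n q) (hm : Covers d ℓ m q) (hnm : n.length ≤ m.length)
    (hmℓ : m.length ≤ ℓ) : n <+: m := by
  induction n generalizing ℓ m q with
  | nil => exact List.nil_prefix
  | cons a n ih =>
    obtain _ | ⟨b, m⟩ := m
    · simp at hnm
    obtain ⟨k, rfl⟩ : ∃ k, ℓ = k + 1 := ⟨ℓ - 1, by simp at hmℓ; omega⟩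
    simp only [List.length_cons, add_le_add_iff_right] at hnm hmℓ
    have div_eq : ∀ (c : Fin (2 ^ d)) (l : List (Fin (2 ^ d))), l.length ≤ k →
        Covers d (k + 1) (c :: l) q →
        (∀ i : Fin d, c.val / 2 ^ (i : ℕ) % 2 = q i / 2 ^ k) ∧
          Covers d k l (fun i => q i % 2 ^ k) := by
      intro c l hl hc
      have aux : ∀ i : Fin d, c.val / 2 ^ (i : ℕ) % 2 = q i / 2 ^ k := by
        intro i
        have h1 := hc i
        have h2 := corner_add_le hl i
        simp only [corner, List.length_cons, Nat.add_sub_add_right] at h1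
        refine (Nat.div_eq_of_lt_le ?_ ?_).symm
        · omega
        · rw [Nat.add_mul, one_mul]; omega
      refine ⟨aux, fun i => ?_⟩
      have h1 := hc i
      simp only [corner, List.length_cons, Nat.add_sub_add_right, aux i] at h1
      have h3 := Nat.div_add_mod (q i) (2 ^ k)
      rw [mul_comm] at h3
      dsimp only
      omega
    obtain ⟨ha, hn'⟩ := div_eq a n (by omega) hn
    obtain ⟨hb, hm'⟩ := div_eq b m hmℓ hm
    obtain rfl : a = b := eq_of_bits_eq fun i => (ha i).trans (hb i).symm
    rw [List.cons_prefix_cons]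
    exact ⟨rfl, ih hn' hm' hnm hmℓ⟩

theorem IsQuadtree.mem_of_prefix {d ℓ : ℕ} {T : Set (List (Fin (2 ^ d)))}
    (hT : IsQuadtree d ℓ T) {n m : List (Fin (2 ^ d))} (hm : m ∈ T) (h : n <+: m) : n ∈ T := by
  obtain ⟨t, rfl⟩ := h
  induction t using List.reverseRecOn with
  | nil => simpa using hm
  | append_singleton t a ih =>
    apply ih
    have := hT.2.2.1 _ hm (by simp)
    rwa [← List.append_assoc, List.dropLast_concat] at this

theorem IsLeafOf.eq_of_prefix {d ℓ : ℕ} {T : Set (List (Fin (2 ^ d)))}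
    (hT : IsQuadtree d ℓ T) {n m : List (Fin (2 ^ d))} (hn : IsLeafOf d T n) (hm : m ∈ T)
    (h : n <+: m) : n = m := by
  obtain ⟨t, rfl⟩ := h
  obtain _ | ⟨i, t⟩ := t
  · simp
  · exact absurd (hT.mem_of_prefix hm ⟨t, by simp⟩) (hn.2 i)

theorem IsQuadtree.exists_leaf_prefix {d ℓ : ℕ} {T : Set (List (Fin (2 ^ d)))}
    (hT : IsQuadtree d ℓ T) {x : List (Fin (2 ^ d))} (hx : x.length = ℓ) :
    ∃ a, IsLeafOf d T a ∧ a <+: x := by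
  classical
  have h0 : x.take 0 ∈ T := by simpa using hT.1
  set k := Nat.findGreatest (fun k => x.take k ∈ T) ℓ with hk
  have hkT : x.take k ∈ T := Nat.findGreatest_spec (P := fun k => x.take k ∈ T) (Nat.zero_le ℓ) h0
  refine ⟨x.take k, ⟨hkT, fun i hi => ?_⟩, List.take_prefix _ _⟩
  have hlen := hT.2.1 _ hi
  have hkℓ : k ≤ ℓ := Nat.findGreatest_le ℓ
  have hlt : k < x.length := by
    simp at hlen
    omega
  have hmem : x.take (k + 1) ∈ T := by
    rw [List.take_succ_eq_append_getElem hlt]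
    exact hT.2.2.2 _ i _ hi
  have := Nat.le_findGreatest (P := fun k => x.take k ∈ T) (by omega : k + 1 ≤ ℓ) hmem
  omega

theorem IsLeafOf.eq_of_covers {d ℓ : ℕ} {T : Set (List (Fin (2 ^ d)))}
    (hT : IsQuadtree d ℓ T) {n m : List (Fin (2 ^ d))} {q : Fin d → ℕ}
    (hn : IsLeafOf d T n) (hm : IsLeafOf d T m) (hnq : Covers d ℓ n q) (hmq : Covers d ℓ m q) :
    n = m := by
  rcases le_total n.length m.length with h | h
  · exact hn.eq_of_prefix hT hm.1 (prefix_of_covers hnq hmq h (hT.2.1 _ hm.1))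
  · exact (hm.eq_of_prefix hT hn.1 (prefix_of_covers hmq hnq h (hT.2.1 _ hn.1))).symm

/-- Leaves of a quadtree covering two adjacent finest cells coincide or are nodal neighbors. -/
theorem eq_or_nodalNeighbors_of_covers {d ℓ : ℕ} {T : Set (List (Fin (2 ^ d)))}
    (hT : IsQuadtree d ℓ T) {a b : List (Fin (2 ^ d))} {q : Fin d → ℕ} {i : Fin d}
    (ha : IsLeafOf d T a) (hb : IsLeafOf d T b) (haq : Covers d ℓ a q)
    (hbq : Covers d ℓ b (Function.update q i (q i + 1))) :
    a = b ∨ NodalNeighbors d ℓ a b := by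
  by_cases hab : a = b
  · exact Or.inl hab
  refine Or.inr ((nodalNeighbors_iff (hT.2.1 _ ha.1) (hT.2.1 _ hb.1)).2 ?_)
  have hbj : ∀ j, j ≠ i → corner d ℓ b j ≤ q j ∧ q j < corner d ℓ b j + 2 ^ (ℓ - b.length) := by
    intro j hj
    simpa [Function.update_of_ne hj] using hbq j
  have hbi : corner d ℓ b i ≤ q i + 1 ∧ q i + 1 < corner d ℓ b i + 2 ^ (ℓ - b.length) := by
    simpa using hbq i
  have h1 : ¬ q i + 1 < corner d ℓ a i + 2 ^ (ℓ - a.length) := by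
    intro h
    refine hab (ha.eq_of_covers hT hb (q := Function.update q i (q i + 1)) (fun j => ?_) hbq)
    by_cases hj : j = i
    · subst hj
      have := haq j
      simp only [Function.update_self]
      omega
    · simpa [Function.update_of_ne hj] using haq j
  have h2 : ¬ corner d ℓ b i ≤ q i := by
    intro h
    refine hab (ha.eq_of_covers hT hb haq (fun j => ?_))
    by_cases hj : j = i
    · subst hj
      omega
    · exact hbj j hj
  have hai := haq i
  refine ⟨fun j => ?_, i, Or.inr (by omega), fun j hj => ?_⟩
  · by_cases hj : j = i
    · subst hj
      omega
    · have := haq j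
      have := hbj j hj
      omega
  · by_contra hne
    have := haq j
    have := hbj j hne
    dsimp only at hj
    omega

/-- A function on a discrete box that is invariant under unit steps is constant. -/
theorem eq_corner_of_unit_steps {d : ℕ} {α : Type*} (f : (Fin d → ℕ) → α) (lo hi : Fin d → ℕ)
    (hf : ∀ q i, (∀ j, lo j ≤ q j ∧ q j < hi j) → q i + 1 < hi i →
      f q = f (Function.update q i (q i + 1)))
    (q : Fin d → ℕ) (hq : ∀ j, lo j ≤ q j ∧ q j < hi j) : f q = f lo := by
  induction hs : ∑ j, q j using Nat.strong_induction_on generalizing q with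
  | _ s ih =>
  by_cases h : q = lo
  · rw [h]
  obtain ⟨i, hi'⟩ : ∃ i, q i ≠ lo i := by
    by_contra! hcon
    exact h (funext hcon)
  have hqi := hq i
  have hstep := hf (Function.update q i (q i - 1)) i (fun j => by
    by_cases hj : j = i
    · subst hj
      simp only [Function.update_self]
      omega
    · simpa [Function.update_of_ne hj] using hq j) (by simp only [Function.update_self]; omega)
  have hup : Function.update (Function.update q i (q i - 1)) i
      (Function.update q i (q i - 1) i + 1) = q := by
    rw [Function.update_idem, Function.update_self, show q i - 1 + 1 = q i by omega,
      Function.update_eq_self]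
  rw [hup] at hstep
  rw [← hstep]
  refine ih _ ?_ (Function.update q i (q i - 1)) (fun j => ?_) rfl
  · rw [← hs]
    refine Finset.sum_lt_sum (fun j _ => ?_) ⟨i, Finset.mem_univ _, ?_⟩
    · by_cases hj : j = i
      · subst hj
        simp
      · simp [Function.update_of_ne hj]
    · simp only [Function.update_self]
      omega
  · by_cases hj : j = i
    · subst hj
      simp only [Function.update_self]
      omega
    · simpa [Function.update_of_ne hj] using hq j

/-- Nodal neighbors contain adjacent finest cells. -/
theorem exists_adjacent_cells {d ℓ : ℕ} {n m : List (Fin (2 ^ d))}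
    (hn : n.length ≤ ℓ) (hm : m.length ≤ ℓ) (h : NodalNeighbors d ℓ n m) :
    ∃ (q : Fin d → ℕ) (i : Fin d),
      (Covers d ℓ n q ∧ Covers d ℓ m (Function.update q i (q i + 1))) ∨
      (Covers d ℓ m q ∧ Covers d ℓ n (Function.update q i (q i + 1))) := by
  have aux : ∀ n m : List (Fin (2 ^ d)), ∀ i : Fin d,
      corner d ℓ m i = corner d ℓ n i + 2 ^ (ℓ - n.length) →
      (∀ j, j ≠ i → corner d ℓ n j < corner d ℓ m j + 2 ^ (ℓ - m.length) ∧
        corner d ℓ m j < corner d ℓ n j + 2 ^ (ℓ - n.length)) →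
      ∃ q : Fin d → ℕ, Covers d ℓ n q ∧ Covers d ℓ m (Function.update q i (q i + 1)) := by
    intro n m i hi hj
    have hpn : 0 < 2 ^ (ℓ - n.length) := by positivity
    have hpm : 0 < 2 ^ (ℓ - m.length) := by positivity
    refine ⟨Function.update (fun j => max (corner d ℓ n j) (corner d ℓ m j)) i
      (corner d ℓ m i - 1), fun j => ?_, fun j => ?_⟩
    · by_cases hji : j = i
      · subst hji
        simp only [Function.update_self]
        omega
      · have := hj j hji
        simp only [Function.update_of_ne hji]
        omega
    · by_cases hji : j = i
      · subst hji
        simp only [Function.update_self]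
        omega
      · have := hj j hji
        simp only [Function.update_of_ne hji]
        omega
  obtain ⟨hle, i, hi, huniq⟩ := (nodalNeighbors_iff hn hm).1 h
  have hlt : ∀ j, j ≠ i → corner d ℓ n j < corner d ℓ m j + 2 ^ (ℓ - m.length) ∧
      corner d ℓ m j < corner d ℓ n j + 2 ^ (ℓ - n.length) := by
    intro j hj
    have h1 := hle j
    have h2 := mt (huniq j) hj
    dsimp only at h2
    omega
  rcases hi with hi | hi
  · obtain ⟨q, hq⟩ := aux m n i hi fun j hj => (hlt j hj).symm
    exact ⟨q, i, Or.inr hq⟩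
  · obtain ⟨q, hq⟩ := aux n m i hi hlt
    exact ⟨q, i, Or.inl hq⟩

/-- Finest cells of a node have coordinates below `2 ^ ℓ`. -/
theorem Covers.lt_two_pow {d ℓ : ℕ} {n : List (Fin (2 ^ d))} {q : Fin d → ℕ}
    (h : Covers d ℓ n q) (hn : n.length ≤ ℓ) (i : Fin d) : q i < 2 ^ ℓ :=
  (h i).2.trans_le (corner_add_le hn i)

theorem IsQuadtree.exists_leaf_covers {d ℓ : ℕ} {T : Set (List (Fin (2 ^ d)))}
    (hT : IsQuadtree d ℓ T) {n : List (Fin (2 ^ d))} {q : Fin d → ℕ} (hn : n ∈ T)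
    (hq : Covers d ℓ n q) : ∃ a, IsLeafOf d T a ∧ n <+: a ∧ Covers d ℓ a q := by
  obtain ⟨x, hx, rfl⟩ := exists_corner_eq ℓ q (hq.lt_two_pow (hT.2.1 _ hn))
  obtain ⟨a, ha, hax⟩ := hT.exists_leaf_prefix hx
  have haq := (covers_corner (ℓ := ℓ) x).of_prefix hx.le hax
  refine ⟨a, ha, ?_, haq⟩
  rcases le_total n.length a.length with h | h
  · exact prefix_of_covers hq haq h (hT.2.1 _ ha.1)
  · rw [ha.eq_of_prefix hT hn (prefix_of_covers haq hq h (hT.2.1 _ hn))]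

/-- Nodal adjacency on a set of nodes. -/
def nodalGraph (d ℓ : ℕ) (S : Set (List (Fin (2 ^ d)))) : SimpleGraph S where
  Adj a b := NodalNeighbors d ℓ a b
  symm := ⟨fun _ _ h => h.symm⟩
  loopless := ⟨fun a h => not_nodalNeighbors_self a.1 h⟩

/-- Refining a quadtree refines its abstract paths. -/
theorem AbstractPath.exists_refinement {d ℓ : ℕ} {s0 sg : List (Fin (2 ^ d))}
    (hs0 : s0.length = ℓ) (hsg : sg.length = ℓ) {T1 T2 : Set (List (Fin (2 ^ d)))}
    (hT2 : IsQuadtree d ℓ T2) (hsub : T1 ⊆ T2) (P : AbstractPath d ℓ T1 s0 sg) :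
    ∃ Q : AbstractPath d ℓ T2 s0 sg, ∀ i, ∃ j, P.z j <+: Q.z i := by
  have hz : ∀ j, P.z j ∈ T2 := fun j => hsub (P.leaf j).1
  have hlen : ∀ j, (P.z j).length ≤ ℓ := fun j => hT2.2.1 _ (hz j)
  let S : Set (List (Fin (2 ^ d))) := {a | IsLeafOf d T2 a ∧ ∃ j, P.z j <+: a}
  have hex : ∀ j q, Covers d ℓ (P.z j) q → ∃ a : S, Covers d ℓ a q := by
    intro j q hq
    obtain ⟨a, ha, hja, haq⟩ := hT2.exists_leaf_covers (hz j) hq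
    exact ⟨⟨a, ha, j, hja⟩, haq⟩
  obtain ⟨a0, -⟩ := hex 0 _ (covers_corner _)
  have htotal : ∀ q, ∃ a : S, (∃ j, Covers d ℓ (P.z j) q) → Covers d ℓ a q := by
    intro q
    by_cases h : ∃ j, Covers d ℓ (P.z j) q
    · obtain ⟨j, hj⟩ := h
      obtain ⟨a, ha⟩ := hex j q hj
      exact ⟨a, fun _ => ha⟩
    · exact ⟨a0, fun h' => absurd h' h⟩
  choose L hL using htotal
  let f : (Fin d → ℕ) → (nodalGraph d ℓ S).ConnectedComponent :=
    fun q => (nodalGraph d ℓ S).connectedComponentMk (L q)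
  have hstep : ∀ q i j j', Covers d ℓ (P.z j) q →
      Covers d ℓ (P.z j') (Function.update q i (q i + 1)) →
      f q = f (Function.update q i (q i + 1)) := by
    intro q i j j' h h'
    rcases eq_or_nodalNeighbors_of_covers hT2 (L q).2.1 (L _).2.1 (hL q ⟨j, h⟩)
      (hL _ ⟨j', h'⟩) with heq | hnn
    · exact congrArg (nodalGraph d ℓ S).connectedComponentMk (Subtype.ext heq)
    · exact SimpleGraph.ConnectedComponent.eq.2 (SimpleGraph.Adj.reachable hnn)
  have hbox : ∀ j q, Covers d ℓ (P.z j) q → f q = f (corner d ℓ (P.z j)) := by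
    intro j q hq
    refine eq_corner_of_unit_steps f _
      (fun i => corner d ℓ (P.z j) i + 2 ^ (ℓ - (P.z j).length)) (fun q i hq hi => ?_) q hq
    refine hstep q i j j hq fun k => ?_
    by_cases hk : k = i
    · subst hk
      have := hq k
      simp only [Function.update_self]
      omega
    · simpa [Function.update_of_ne hk] using hq k
  have hchain : ∀ j, f (corner d ℓ (P.z j)) = f (corner d ℓ (P.z 0)) := by
    intro j
    induction j using Fin.induction with
    | zero => rfl
    | succ j ih =>
      rw [← ih]
      obtain ⟨q, i, ⟨h1, h2⟩ | ⟨h1, h2⟩⟩ := exists_adjacent_cells (hlen _) (hlen _) (P.neigh j)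
      · rw [← hbox _ _ h1, ← hbox _ _ h2, hstep q i _ _ h1 h2]
      · rw [← hbox _ _ h1, ← hbox _ _ h2, hstep q i _ _ h1 h2]
  have hc0 := (covers_corner (ℓ := ℓ) s0).of_prefix hs0.le P.start
  have hcg := (covers_corner (ℓ := ℓ) sg).of_prefix hsg.le P.goal
  have hreach : (nodalGraph d ℓ S).Reachable (L (corner d ℓ s0)) (L (corner d ℓ sg)) := by
    refine SimpleGraph.ConnectedComponent.eq.1 (?_ : f _ = f _)
    rw [hbox _ _ hc0, hbox _ _ hcg, hchain (Fin.last _)]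
  have hprefix : ∀ (s : List (Fin (2 ^ d))) (j), s.length = ℓ → Covers d ℓ (P.z j) (corner d ℓ s) →
      (L (corner d ℓ s)).1 <+: s := fun s j hs h =>
    prefix_of_covers (hL _ ⟨j, h⟩) (covers_corner s)
      (hs ▸ hT2.2.1 _ (L (corner d ℓ s)).2.1.1) hs.le
  obtain ⟨w, hw⟩ := hreach.exists_isPath
  exact ⟨{
    R := w.length
    z := fun i => (w.getVert i).1
    inj := fun i j hij => Fin.ext (hw.getVert_injOn (Nat.lt_succ_iff.1 i.isLt)
      (Nat.lt_succ_iff.1 j.isLt) (Subtype.ext hij))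
    leaf := fun i => (w.getVert i).2.1
    start := by simpa using hprefix s0 _ hs0 hc0
    goal := by simpa using hprefix sg _ hsg hcg
    neigh := fun i => w.adj_getVert_succ i.isLt }, fun i => (w.getVert i).2.2⟩

theorem sum_ite_append_prefix {d : ℕ} {n x : List (Fin (2 ^ d))} (h : n.length < x.length)
    (r : ℝ) : ∑ i, (if n ++ [i] <+: x then r else 0) = if n <+: x then r else 0 := by
  by_cases hx : n <+: x
  · obtain ⟨t, rfl⟩ := hx
    obtain _ | ⟨a, t⟩ := t
    · simp at h
    · simp [List.prefix_append_right_inj, List.cons_prefix_cons]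
  · rw [if_neg hx]
    refine Finset.sum_eq_zero fun i _ => if_neg fun hi => hx ?_
    exact (List.prefix_append _ _).trans hi

/-- The weight of a node in the path cost is the total cost of its leaf descendants. -/
theorem weight_eq_sum_leaves {d ℓ : ℕ} (c : List (Fin (2 ^ d)) → ℝ) {n : List (Fin (2 ^ d))}
    (hn : n.length ≤ ℓ) :
    (2 : ℝ) ^ (d * (ℓ - n.length)) * Vnode d ℓ c n =
      ∑ x ∈ (List.finite_length_eq (Fin (2 ^ d)) ℓ).toFinset, if n <+: x then c x else 0 := by
  unfold Vnode
  generalize hk : ℓ - n.length = k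
  induction k generalizing n with
  | zero =>
    have hnℓ : n.length = ℓ := by omega
    rw [Finset.sum_eq_single n]
    · simp [Vaux]
    · intro x hx hne
      simp only [Set.Finite.mem_toFinset, Set.mem_ofPred_eq] at hx
      exact if_neg fun h => hne (h.eq_of_length (by omega)).symm
    · intro h
      simp [hnℓ] at h
  | succ k ih =>
    have hih : ∀ i : Fin (2 ^ d), _ := fun i => ih (n := n ++ [i]) (by simp; omega) (by simp; omega)
    rw [Vaux, Nat.mul_succ, pow_add, mul_assoc, ← mul_assoc ((2 : ℝ) ^ d),
      mul_inv_cancel₀ (by positivity), one_mul, Finset.mul_sum, Finset.sum_congr rfl fun i _ => hih i,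
      Finset.sum_comm]
    refine Finset.sum_congr rfl fun x hx => sum_ite_append_prefix ?_ _
    simp only [Set.Finite.mem_toFinset, Set.mem_ofPred_eq] at hx
    omega

theorem pathCost_eq_sum_leaves {d ℓ : ℕ} (c : List (Fin (2 ^ d)) → ℝ)
    {T : Set (List (Fin (2 ^ d)))} (hT : IsQuadtree d ℓ T) {s0 sg : List (Fin (2 ^ d))}
    (P : AbstractPath d ℓ T s0 sg) :
    pathCost d ℓ c P = ∑ x ∈ (List.finite_length_eq (Fin (2 ^ d)) ℓ).toFinset,
      ∑ i, if P.z i <+: x then c x else 0 := by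
  rw [Finset.sum_comm]
  exact Finset.sum_congr rfl fun i _ => weight_eq_sum_leaves c (hT.2.1 _ (P.leaf i).1)

theorem pathCost_nonneg {d ℓ : ℕ} {c : List (Fin (2 ^ d)) → ℝ}
    (hc : ∀ x : List (Fin (2 ^ d)), x.length = ℓ → 0 ≤ c x)
    {T : Set (List (Fin (2 ^ d)))} (hT : IsQuadtree d ℓ T) {s0 sg : List (Fin (2 ^ d))}
    (P : AbstractPath d ℓ T s0 sg) : 0 ≤ pathCost d ℓ c P := by
  rw [pathCost_eq_sum_leaves c hT]
  refine Finset.sum_nonneg fun x hx => Finset.sum_nonneg fun i _ => ?_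
  have := hc x (by simpa using hx)
  split_ifs <;> simp [this]

theorem pathCost_le_of_refinement {d ℓ : ℕ} {c : List (Fin (2 ^ d)) → ℝ}
    (hc : ∀ x : List (Fin (2 ^ d)), x.length = ℓ → 0 ≤ c x)
    {T1 T2 : Set (List (Fin (2 ^ d)))} (hT1 : IsQuadtree d ℓ T1) (hT2 : IsQuadtree d ℓ T2)
    {s0 sg : List (Fin (2 ^ d))} (P : AbstractPath d ℓ T1 s0 sg) (Q : AbstractPath d ℓ T2 s0 sg)
    (hPQ : ∀ i, ∃ j, P.z j <+: Q.z i) : pathCost d ℓ c Q ≤ pathCost d ℓ c P := by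
  rw [pathCost_eq_sum_leaves c hT1, pathCost_eq_sum_leaves c hT2]
  refine Finset.sum_le_sum fun x hx => ?_
  have hcx := hc x (by simpa using hx)
  have hnonneg : ∀ j, 0 ≤ if P.z j <+: x then c x else 0 := fun j => by
    split_ifs <;> simp [hcx]
  by_cases h : ∃ i, Q.z i <+: x
  · obtain ⟨i, hi⟩ := h
    obtain ⟨j, hj⟩ := hPQ i
    rw [Finset.sum_eq_single i]
    · calc (if Q.z i <+: x then c x else 0) = if P.z j <+: x then c x else 0 := by
            rw [if_pos hi, if_pos (hj.trans hi)]
        _ ≤ _ := Finset.single_le_sum (f := fun j => if P.z j <+: x then c x else 0)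
            (fun j _ => hnonneg j) (Finset.mem_univ j)
    · intro k _ hk
      refine if_neg fun hkx => hk (Q.inj ?_)
      rcases List.prefix_or_prefix_of_prefix hkx hi with h | h
      · exact (Q.leaf k).eq_of_prefix hT2 (Q.leaf i).1 h
      · exact ((Q.leaf i).eq_of_prefix hT2 (Q.leaf k).1 h).symm
    · simp
  · push Not at h
    rw [Finset.sum_eq_zero fun i _ => if_neg (h i)]
    exact Finset.sum_nonneg fun j _ => hnonneg j

theorem cst_nonneg {d ℓ : ℕ} {p : List (Fin (2 ^ d)) → ℝ} {ε lam1 lam2 γ : ℝ}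
    {x : List (Fin (2 ^ d))} (hp : 0 ≤ p x) (hε : 0 ≤ ε) (h1 : 0 ≤ lam1) (h2 : 0 ≤ lam2)
    (hγ : 0 ≤ γ) : 0 ≤ cst d ℓ p ε lam1 lam2 γ x := by
  unfold cst Mval
  split_ifs <;> positivity

/-- If `T1 ⊆ T2` are quadtrees and `T1` admits an abstract path, then `T2` admits an
abstract path and the minimal abstract-path cost in `T2` is at most that in `T1`. -/
theorem statement1
    (d ℓ : ℕ) (hd : 1 ≤ d) (hℓ : 1 ≤ ℓ)
    (p : List (Fin (2 ^ d)) → ℝ)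
    (hp : ∀ x : List (Fin (2 ^ d)), x.length = ℓ → 0 ≤ p x ∧ p x ≤ 1)
    (ε lam1 lam2 γ : ℝ)
    (hε0 : 0 ≤ ε) (hε1 : ε ≤ 1) (h10 : 0 < lam1) (h11 : lam1 ≤ 1)
    (h20 : 0 ≤ lam2) (h21 : lam2 ≤ 1) (hγ : 0 < γ)
    (s0 sg : List (Fin (2 ^ d))) (hs0 : s0.length = ℓ) (hsg : sg.length = ℓ)
    (T1 T2 : Set (List (Fin (2 ^ d))))
    (hT1 : IsQuadtree d ℓ T1) (hT2 : IsQuadtree d ℓ T2) (hsub : T1 ⊆ T2)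
    (hne : Nonempty (AbstractPath d ℓ T1 s0 sg)) :
    Nonempty (AbstractPath d ℓ T2 s0 sg) ∧
      sInf {x : ℝ | ∃ pth : AbstractPath d ℓ T2 s0 sg,
          x = pathCost d ℓ (cst d ℓ p ε lam1 lam2 γ) pth} ≤
        sInf {x : ℝ | ∃ pth : AbstractPath d ℓ T1 s0 sg,
          x = pathCost d ℓ (cst d ℓ p ε lam1 lam2 γ) pth} := by
  have hc : ∀ x : List (Fin (2 ^ d)), x.length = ℓ → 0 ≤ cst d ℓ p ε lam1 lam2 γ x :=
    fun x hx => cst_nonneg (hp x hx).1 hε0 h10.le h20 hγ.le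
  obtain ⟨P⟩ := hne
  obtain ⟨Q, -⟩ := P.exists_refinement hs0 hsg hT2 hsub
  refine ⟨⟨Q⟩, le_csInf ⟨_, P, rfl⟩ ?_⟩
  rintro _ ⟨P', rfl⟩
  obtain ⟨Q', hQ'⟩ := P'.exists_refinement hs0 hsg hT2 hsub
  have hbdd : BddBelow {x : ℝ | ∃ pth : AbstractPath d ℓ T2 s0 sg,
      x = pathCost d ℓ (cst d ℓ p ε lam1 lam2 γ) pth} := by
    refine ⟨0, ?_⟩
    rintro _ ⟨R, rfl⟩
    exact pathCost_nonneg hc hT2 R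
  exact (csInf_le hbdd ⟨Q', rfl⟩).trans (pathCost_le_of_refinement hc hT1 hT2 P' Q' hQ')
end

section
/- For every interior node n: V(n) > λ1 + ε·λ2 if and only if there exists a leaf descendant x of n with p(x) > ε. -/
open Finset

theorem Vaux_le (d : ℕ) (c : List (Fin (2 ^ d)) → ℝ) (B : ℝ) (k : ℕ)
    (n : List (Fin (2 ^ d))) (h : ∀ t, t.length = k → c (n ++ t) ≤ B) :
    Vaux d c k n ≤ B := by
  induction k generalizing n with
  | zero => simpa [Vaux] using h []
  | succ k ih =>
    have hsum : ∑ i : Fin (2 ^ d), Vaux d c k (n ++ [i]) ≤ ∑ _i : Fin (2 ^ d), B :=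
      Finset.sum_le_sum fun i _ => ih _ fun t ht => by
        simpa using h (i :: t) (by simp [ht])
    rw [Vaux, inv_mul_le_iff₀ (by positivity)]
    simpa using hsum

theorem Vaux_nonneg (d : ℕ) (c : List (Fin (2 ^ d)) → ℝ) (k : ℕ)
    (n : List (Fin (2 ^ d))) (h : ∀ t, t.length = k → 0 ≤ c (n ++ t)) :
    0 ≤ Vaux d c k n := by
  induction k generalizing n with
  | zero => simpa [Vaux] using h []
  | succ k ih =>
    exact mul_nonneg (by positivity) <| Finset.sum_nonneg fun i _ => ih _ fun t ht => by
      simpa using h (i :: t) (by simp [ht])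

theorem le_two_pow_mul_Vaux (d : ℕ) (c : List (Fin (2 ^ d)) → ℝ) (k : ℕ)
    (n : List (Fin (2 ^ d))) (h : ∀ t, t.length = k → 0 ≤ c (n ++ t))
    (t : List (Fin (2 ^ d))) (ht : t.length = k) :
    c (n ++ t) ≤ 2 ^ (d * k) * Vaux d c k n := by
  induction k generalizing n t with
  | zero => simp [Vaux, List.length_eq_zero_iff.mp ht]
  | succ k ih =>
    obtain _ | ⟨i, t⟩ := t
    · simp at ht
    have hchild : ∀ j : Fin (2 ^ d), ∀ s : List (Fin (2 ^ d)), s.length = k →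
        0 ≤ c (n ++ [j] ++ s) :=
      fun j s hs => by simpa using h (j :: s) (by simp [hs])
    calc c (n ++ i :: t) = c (n ++ [i] ++ t) := by simp
      _ ≤ 2 ^ (d * k) * Vaux d c k (n ++ [i]) := ih _ (hchild i) t (by simpa using ht)
      _ ≤ 2 ^ (d * k) * ∑ j : Fin (2 ^ d), Vaux d c k (n ++ [j]) := by
        gcongr
        exact Finset.single_le_sum (f := fun j => Vaux d c k (n ++ [j]))
          (fun j _ => Vaux_nonneg d c k _ (hchild j)) (Finset.mem_univ i)
      _ = 2 ^ (d * (k + 1)) * Vaux d c (k + 1) n := by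
        rw [Vaux, mul_add, mul_one, pow_add]
        field_simp

/-- Proposition 3: for every interior node `n`, `V(n) > λ₁ + ε λ₂` iff some leaf
descendant `x` of `n` satisfies `p(x) > ε`. -/
theorem statement7
    (d ℓ : ℕ) (hd : 1 ≤ d) (hℓ : 1 ≤ ℓ)
    (p : List (Fin (2 ^ d)) → ℝ)
    (hp : ∀ x : List (Fin (2 ^ d)), x.length = ℓ → 0 ≤ p x ∧ p x ≤ 1)
    (ε lam1 lam2 γ : ℝ)
    (hε0 : 0 ≤ ε) (hε1 : ε ≤ 1) (h10 : 0 < lam1) (h11 : lam1 ≤ 1)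
    (h20 : 0 ≤ lam2) (h21 : lam2 ≤ 1) (hγ : 0 < γ)
    (n : List (Fin (2 ^ d))) (hn : n.length < ℓ) :
    lam1 + ε * lam2 < Vnode d ℓ (cst d ℓ p ε lam1 lam2 γ) n ↔
      ∃ x : List (Fin (2 ^ d)), n <+: x ∧ x.length = ℓ ∧ ε < p x := by
  have hB : 0 ≤ lam1 + ε * lam2 := by positivity
  rw [Vnode]
  constructor
  · contrapose!
    intro h
    refine Vaux_le d _ _ _ n fun t ht => ?_
    have hpt := h (n ++ t) (List.prefix_append n t) (by simp; omega)
    rw [cst, if_pos hpt, mul_comm ε]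
    gcongr
  · rintro ⟨x, ⟨t, rfl⟩, hx, hpx⟩
    have ht : t.length = ℓ - n.length := by simp at hx; omega
    have hnonneg : ∀ s : List (Fin (2 ^ d)), s.length = ℓ - n.length →
        0 ≤ cst d ℓ p ε lam1 lam2 γ (n ++ s) := by
      intro s hs
      have hps := (hp (n ++ s) (by simp; omega)).1
      unfold cst Mval
      split_ifs <;> positivity
    have hle := le_two_pow_mul_Vaux d _ _ n hnonneg t ht
    rw [cst, if_neg hpx.not_ge, Mval] at hle
    have hpow : (2 : ℝ) ^ (d * (ℓ - n.length)) * (lam1 + ε * lam2)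
        ≤ 2 ^ (d * ℓ) * (lam1 + ε * lam2) := by
      gcongr
      · norm_num
      · omega
    exact lt_of_mul_lt_mul_left (by linarith) (by positivity : (0 : ℝ) ≤ 2 ^ (d * (ℓ - n.length)))
end

section
/- For every interior node n, Q(n; β) tends to ∑_{s ∈ Int(n)} a(s) as β → ∞ (i.e., the function β ↦ Q(n; β) tends to this limit along the filter atTop). -/
open Finset Filter

/-- Auxiliary recursion for `P`: fuel equals `ℓ - length`; `P = 0` on leaves and
`P(n) = L(n) + ∑_{n' child of n} P(n')` on interior nodes. -/
noncomputable def Paux (d : ℕ) (L : List (Fin (2 ^ d)) → ℝ) : ℕ → List (Fin (2 ^ d)) → ℝ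
  | 0, _ => 0
  | k + 1, n => L n + ∑ i : Fin (2 ^ d), Paux d L k (n ++ [i])

/-- `P(n; β)` with `ΔL̃(n; β) = a(n) - b(n)/β`. -/
noncomputable def Pfun (d ℓ : ℕ) (a b : List (Fin (2 ^ d)) → ℝ) (β : ℝ)
    (n : List (Fin (2 ^ d))) : ℝ :=
  Paux d (fun m => a m - b m / β) (ℓ - n.length) n

/-- Auxiliary recursion for `Q`: fuel equals `ℓ - length`; `Q = 0` on leaves and
`Q(n) = max{L(n) + ∑_{n' child of n} Q(n'), 0}` on interior nodes. -/
noncomputable def Qaux (d : ℕ) (L : List (Fin (2 ^ d)) → ℝ) : ℕ → List (Fin (2 ^ d)) → ℝ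
  | 0, _ => 0
  | k + 1, n => max (L n + ∑ i : Fin (2 ^ d), Qaux d L k (n ++ [i])) 0

/-- `Q(n; β)` with `ΔL̃(n; β) = a(n) - b(n)/β`. -/
noncomputable def Qfun (d ℓ : ℕ) (a b : List (Fin (2 ^ d)) → ℝ) (β : ℝ)
    (n : List (Fin (2 ^ d))) : ℝ :=
  Qaux d (fun m => a m - b m / β) (ℓ - n.length) n

/-- `Int(n)`: the finite set of interior nodes (length `< ℓ`) having `n` as a prefix,
including `n` itself: all `n ++ t` with `|n| + |t| < ℓ`. -/
def IntSet (d ℓ : ℕ) (n : List (Fin (2 ^ d))) : Finset (List (Fin (2 ^ d))) :=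
  (Finset.range (ℓ - n.length)).biUnion fun k =>
    Finset.image (fun f : Fin k → Fin (2 ^ d) => n ++ List.ofFn f) Finset.univ

/-- Unfolding the recursion for `P`: it is the sum of `L` over the descendants, level by level. -/
theorem Paux_eq_sum (d : ℕ) (L : List (Fin (2 ^ d)) → ℝ) (k : ℕ) (n : List (Fin (2 ^ d))) :
    Paux d L k n = ∑ j ∈ range k, ∑ f : Fin j → Fin (2 ^ d), L (n ++ List.ofFn f) := by
  induction k generalizing n with
  | zero => simp [Paux]
  | succ k ih =>
    have step (j : ℕ) : ∑ f : Fin (j + 1) → Fin (2 ^ d), L (n ++ List.ofFn f) =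
        ∑ i : Fin (2 ^ d), ∑ f : Fin j → Fin (2 ^ d), L (n ++ [i] ++ List.ofFn f) := by
      rw [← (Fin.consEquiv fun _ : Fin (j + 1) => Fin (2 ^ d)).sum_comp, Fintype.sum_prod_type]
      simp [Fin.consEquiv, List.ofFn_succ]
    rw [sum_range_succ', Paux]
    simp_rw [ih, step]
    rw [sum_comm, add_comm]
    simp

theorem sum_IntSet (d ℓ : ℕ) (L : List (Fin (2 ^ d)) → ℝ) (n : List (Fin (2 ^ d))) :
    ∑ s ∈ IntSet d ℓ n, L s = Paux d L (ℓ - n.length) n := by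
  rw [Paux_eq_sum, IntSet, sum_biUnion]
  · refine sum_congr rfl fun j _ => sum_image fun f _ g _ h => ?_
    exact List.ofFn_injective (List.append_cancel_left h)
  · intro i _ j _ hij
    refine disjoint_left.2 fun s hi hj => hij ?_
    obtain ⟨f, -, rfl⟩ := mem_image.1 hi
    obtain ⟨g, -, hg⟩ := mem_image.1 hj
    simpa using (congrArg List.length hg).symm

theorem Paux_nonneg (d ℓ : ℕ) (L : List (Fin (2 ^ d)) → ℝ)
    (hL : ∀ n : List (Fin (2 ^ d)), n.length < ℓ → 0 ≤ L n)
    (k : ℕ) (n : List (Fin (2 ^ d))) (hk : n.length + k ≤ ℓ) : 0 ≤ Paux d L k n := by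
  induction k generalizing n with
  | zero => simp [Paux]
  | succ k ih =>
    rw [Paux]
    refine add_nonneg (hL n (by omega)) (sum_nonneg fun i _ => ih _ ?_)
    simp only [List.length_append, List.length_singleton]
    omega

theorem tendsto_Qaux (d ℓ : ℕ) (a b : List (Fin (2 ^ d)) → ℝ)
    (ha : ∀ n : List (Fin (2 ^ d)), n.length < ℓ → 0 ≤ a n)
    (k : ℕ) (n : List (Fin (2 ^ d))) (hk : n.length + k ≤ ℓ) :
    Tendsto (fun β : ℝ => Qaux d (fun m => a m - b m / β) k n) atTop (nhds (Paux d a k n)) := by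
  induction k generalizing n with
  | zero => simp [Qaux, Paux]
  | succ k ih =>
    have hdiv : Tendsto (fun β : ℝ => a n - b n / β) atTop (nhds (a n)) := by
      simpa using (tendsto_const_nhds (x := a n)).sub
        ((tendsto_const_nhds (x := b n)).div_atTop tendsto_id)
    have hsum := tendsto_finsetSum (univ : Finset (Fin (2 ^ d))) fun i _ =>
      ih (n ++ [i]) (by simp only [List.length_append, List.length_singleton]; omega)
    have hmax := (hdiv.add hsum).max (tendsto_const_nhds (x := (0 : ℝ)))
    rw [max_eq_left (by simpa only [Paux] using Paux_nonneg d ℓ a ha _ n hk)] at hmax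
    simpa only [Qaux, Paux] using hmax

/-- Lemma 4: `Q(n; β) → ∑_{s ∈ Int(n)} a(s)` as `β → ∞`. -/
theorem statement13
    (d ℓ : ℕ) (hd : 1 ≤ d) (hℓ : 1 ≤ ℓ)
    (a b : List (Fin (2 ^ d)) → ℝ)
    (ha : ∀ n : List (Fin (2 ^ d)), n.length < ℓ → 0 ≤ a n)
    (hb : ∀ n : List (Fin (2 ^ d)), n.length < ℓ → 0 ≤ b n)
    (n : List (Fin (2 ^ d))) (hn : n.length < ℓ) :
    Tendsto (fun β : ℝ => Qfun d ℓ a b β n) atTop (nhds (∑ s ∈ IntSet d ℓ n, a s)) := by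
  rw [sum_IntSet]
  exact tendsto_Qaux d ℓ a b ha _ n (by omega)
end
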